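/- arXiv:2202.12035 — 2 statements merged into one kernel-verified Lean document; each statement's English description precedes it below -/
import Mathlib

section
/- Let A be a bisymmetric payoff tensor on Sym_m × Sym_n. Then the optimal values of the two semidefinite programs characterizing the players' a-priori strategies coincide: sup{ v : ∃ X ∈ 𝒳_m with A(X) − v·I_n ⪰ 0 } = inf{ u : ∃ Y ∈ 𝒳_n with u·I_m − Aᵀ(Y) ⪰ 0 }, and both optimal values are attained. -/
open Matrix BigOperators

/-- The spectraplex: real symmetric positive semidefinite `n×n` matrices with trace 1. -/
def Spectraplex (n : ℕ) : Set (Matrix (Fin n) (Fin n) ℝ) :=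
  {X | X.IsSymm ∧ X.PosSemidef ∧ X.trace = 1}

/-- A bisymmetric payoff tensor. -/
def Bisymm {m n : ℕ} (A : Fin m → Fin m → Fin n → Fin n → ℝ) : Prop :=
  ∀ i j k l, A i j k l = A j i k l ∧ A i j k l = A i j l k

/-- The slice matrix `A(X) ∈ Sym_n`, with entries `A(X)_{kl} = Σ_{i,j} X_{ij} A_{ijkl}`. -/
def sliceX {m n : ℕ} (A : Fin m → Fin m → Fin n → Fin n → ℝ)
    (X : Matrix (Fin m) (Fin m) ℝ) : Matrix (Fin n) (Fin n) ℝ :=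
  Matrix.of fun k l => ∑ i, ∑ j, X i j * A i j k l

/-- The slice matrix `Aᵀ(Y) ∈ Sym_m`, with entries `Aᵀ(Y)_{ij} = Σ_{k,l} A_{ijkl} Y_{kl}`. -/
def sliceY {m n : ℕ} (A : Fin m → Fin m → Fin n → Fin n → ℝ)
    (Y : Matrix (Fin n) (Fin n) ℝ) : Matrix (Fin m) (Fin m) ℝ :=
  Matrix.of fun i j => ∑ k, ∑ l, A i j k l * Y k l

namespace Spectraplex

lemma convex (n : ℕ) : Convex ℝ (Spectraplex n) := by
  rintro X ⟨hX, hXp, hXt⟩ Y ⟨hY, hYp, hYt⟩ a b ha hb hab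
  refine ⟨?_, (hXp.smul ha).add (hYp.smul hb), ?_⟩
  · simp [Matrix.IsSymm, hX.eq, hY.eq]
  · simp [hXt, hYt, hab]

lemma vecMulVec_mem {n : ℕ} {x : Fin n → ℝ} (hx : x ⬝ᵥ x = 1) :
    vecMulVec x x ∈ Spectraplex n := by
  refine ⟨?_, ?_, ?_⟩
  · simp [Matrix.IsSymm, transpose_vecMulVec]
  · simpa using posSemidef_vecMulVec_self_star x
  · rw [trace_vecMulVec, hx]

lemma nonempty {n : ℕ} (hn : 1 ≤ n) : (Spectraplex n).Nonempty :=
  ⟨_, vecMulVec_mem (x := Pi.single ⟨0, hn⟩ 1) (by simp)⟩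

lemma isClosed (n : ℕ) : IsClosed (Spectraplex n) := by
  simp only [Spectraplex, posSemidef_iff_dotProduct_mulVec, Set.ofPred_and, Set.ofPred_forall,
    Matrix.IsSymm, IsHermitian]
  refine .inter (isClosed_eq (by fun_prop) (by fun_prop)) (.inter (.inter
    (isClosed_eq (by fun_prop) (by fun_prop)) (isClosed_iInter fun x => ?_)) ?_)
  · exact isClosed_le (by fun_prop) (by fun_prop)
  · exact isClosed_eq (by fun_prop) (by fun_prop)

lemma abs_apply_le_one {n : ℕ} {X : Matrix (Fin n) (Fin n) ℝ} (hX : X ∈ Spectraplex n)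
    (i j : Fin n) : |X i j| ≤ 1 := by
  obtain ⟨hs, hp, ht⟩ := hX
  have hle (i : Fin n) : X i i ≤ 1 :=
    ht ▸ Finset.single_le_sum (f := fun i => X i i) (fun _ _ => hp.diag_nonneg)
      (Finset.mem_univ i)
  have hdet := (hp.submatrix ![i, j]).det_nonneg
  simp only [det_fin_two, submatrix_apply, cons_val_zero, cons_val_one, hs.apply i j] at hdet
  rw [← sq_le_one_iff_abs_le_one]
  nlinarith [mul_le_one₀ (hle i) hp.diag_nonneg (hle j)]

lemma isCompact (n : ℕ) : IsCompact (Spectraplex n) := by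
  have hbox : IsCompact {X : Matrix (Fin n) (Fin n) ℝ | ∀ i j, X i j ∈ Set.Icc (-1 : ℝ) 1} := by
    have h := isCompact_pi_infinite (X := fun _ : Fin n => Fin n → ℝ)
      fun _ => isCompact_pi_infinite (X := fun _ : Fin n => ℝ)
        fun _ => isCompact_Icc (a := (-1 : ℝ)) (b := 1)
    exact h
  exact hbox.of_isClosed_subset (isClosed n) fun X hX i j =>
    abs_le.mp (abs_apply_le_one hX i j)

end Spectraplex

lemma Matrix.PosSemidef.trace_mul_nonneg {n : ℕ} {M Y : Matrix (Fin n) (Fin n) ℝ}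
    (hM : M.PosSemidef) (hY : Y.PosSemidef) : 0 ≤ (M * Y).trace := by
  obtain ⟨r, v, rfl⟩ := posSemidef_iff_eq_sum_vecMulVec.mp hY
  rw [Finset.mul_sum, trace_sum]
  refine Finset.sum_nonneg fun i _ => ?_
  rw [mul_vecMulVec, trace_vecMulVec, dotProduct_comm]
  exact hM.dotProduct_mulVec_nonneg _

/-- The variational characterization of the lower spectral bounds of a symmetric matrix. -/
lemma posSemidef_sub_smul_one_iff {n : ℕ} {M : Matrix (Fin n) (Fin n) ℝ} (hM : M.IsSymm)
    (v : ℝ) : (M - v • (1 : Matrix (Fin n) (Fin n) ℝ)).PosSemidef ↔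
      ∀ Y ∈ Spectraplex n, v ≤ (M * Y).trace := by
  refine ⟨fun h Y hY => ?_, fun h => .of_dotProduct_mulVec_nonneg ?_ fun x => ?_⟩
  · have := h.trace_mul_nonneg hY.2.1
    simpa [sub_mul, hY.2.2] using this
  · simp [IsHermitian, hM.eq]
  · rcases eq_or_ne x 0 with rfl | hx
    · simp
    have hpos : 0 < x ⬝ᵥ x := by simpa using dotProduct_star_self_pos_iff.mpr hx
    set c := (Real.sqrt (x ⬝ᵥ x))⁻¹ with hc
    have hcc : c * c * (x ⬝ᵥ x) = 1 := by
      rw [hc, ← mul_inv, Real.mul_self_sqrt hpos.le, inv_mul_cancel₀ hpos.ne']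
    have hv := h _ (Spectraplex.vecMulVec_mem (x := c • x) (by simpa [mul_assoc] using hcc))
    rw [mul_vecMulVec, trace_vecMulVec, dotProduct_comm] at hv
    simp only [mulVec_smul, dotProduct_smul, smul_dotProduct, smul_eq_mul] at hv
    simp only [star_trivial, sub_mulVec, smul_mulVec, one_mulVec, dotProduct_sub,
      dotProduct_smul, smul_eq_mul, sub_nonneg]
    calc v * (x ⬝ᵥ x) ≤ c * (c * (x ⬝ᵥ M *ᵥ x)) * (x ⬝ᵥ x) := by gcongr
      _ = c * c * (x ⬝ᵥ x) * (x ⬝ᵥ M *ᵥ x) := by ring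
      _ = x ⬝ᵥ M *ᵥ x := by rw [hcc, one_mul]

lemma posSemidef_smul_one_sub_iff {n : ℕ} {M : Matrix (Fin n) (Fin n) ℝ} (hM : M.IsSymm)
    (u : ℝ) : (u • (1 : Matrix (Fin n) (Fin n) ℝ) - M).PosSemidef ↔
      ∀ X ∈ Spectraplex n, (M * X).trace ≤ u := by
  have h := posSemidef_sub_smul_one_iff hM.neg (-u)
  simpa [sub_eq_add_neg, add_comm] using h

lemma Bisymm.sliceX_isSymm {m n : ℕ} {A : Fin m → Fin m → Fin n → Fin n → ℝ} (hA : Bisymm A)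
    (X : Matrix (Fin m) (Fin m) ℝ) : (sliceX A X).IsSymm := by
  ext k l
  simp [sliceX, fun i j => (hA i j l k).2]

lemma Bisymm.sliceY_isSymm {m n : ℕ} {A : Fin m → Fin m → Fin n → Fin n → ℝ} (hA : Bisymm A)
    (Y : Matrix (Fin n) (Fin n) ℝ) : (sliceY A Y).IsSymm := by
  ext i j
  simp [sliceY, fun k l => (hA j i k l).1]

lemma Matrix.trace_transpose_mul_eq_sum {n : ℕ} (M Y : Matrix (Fin n) (Fin n) ℝ) :
    (Mᵀ * Y).trace = ∑ k, ∑ l, M k l * Y k l := by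
  simp only [trace, diag_apply, mul_apply, transpose_apply]
  exact Finset.sum_comm

lemma Bisymm.trace_sliceX_mul {m n : ℕ} {A : Fin m → Fin m → Fin n → Fin n → ℝ} (hA : Bisymm A)
    (X : Matrix (Fin m) (Fin m) ℝ) (Y : Matrix (Fin n) (Fin n) ℝ) :
    (sliceX A X * Y).trace = (sliceY A Y * X).trace := by
  rw [← (hA.sliceX_isSymm X).eq, ← (hA.sliceY_isSymm Y).eq]
  simp only [trace_transpose_mul_eq_sum, sliceX, sliceY, of_apply, Finset.sum_mul]
  simp_rw [← Fintype.sum_prod_type']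
  exact Fintype.sum_equiv
    ⟨fun p => (p.2.2.1, p.2.2.2, p.1, p.2.1), fun p => (p.2.2.1, p.2.2.2, p.1, p.2.1),
      fun _ => rfl, fun _ => rfl⟩ _ _ fun p => by dsimp; ring

theorem strategy_SDPs_strong_duality {m n : ℕ} (hm : 1 ≤ m) (hn : 1 ≤ n)
    (A : Fin m → Fin m → Fin n → Fin n → ℝ) (hA : Bisymm A) :
    ∃ V : ℝ,
      IsGreatest
        {v : ℝ | ∃ X ∈ Spectraplex m,
          (sliceX A X - v • (1 : Matrix (Fin n) (Fin n) ℝ)).PosSemidef} V ∧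
      IsLeast
        {u : ℝ | ∃ Y ∈ Spectraplex n,
          (u • (1 : Matrix (Fin m) (Fin m) ℝ) - sliceY A Y).PosSemidef} V := by
  let f (Y : Matrix (Fin n) (Fin n) ℝ) (X : Matrix (Fin m) (Fin m) ℝ) : ℝ :=
    (sliceX A X * Y).trace
  have hf (Y X) : f Y X = (sliceY A Y * X).trace := hA.trace_sliceX_mul X Y
  have hY (X) : IsLinearMap ℝ (f · X) := ⟨by simp [f, mul_add], by simp [f]⟩
  have hX (Y) : IsLinearMap ℝ (f Y) := by
    constructor <;> intros <;> simp [hf, mul_add]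
  obtain ⟨Y₀, hY₀, X₀, hX₀, hsaddle⟩ :
      ∃ Y ∈ Spectraplex n, ∃ X ∈ Spectraplex m,
        IsSaddlePointOn (Spectraplex n) (Spectraplex m) f Y X := by
    refine Sion.exists_isSaddlePointOn (Spectraplex.nonempty hn) (Spectraplex.convex n)
      (Spectraplex.isCompact n) (fun X _ => ?_) (fun X _ => ?_) (Spectraplex.convex m)
      (Spectraplex.nonempty hm) (Spectraplex.isCompact m) (fun Y _ => ?_) (fun Y _ => ?_)
    · exact Continuous.lowerSemicontinuous (by fun_prop) |>.lowerSemicontinuousOn _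
    · exact ((hY X).mk' _ |>.convexOn (Spectraplex.convex n)).quasiconvexOn
    · refine Continuous.upperSemicontinuous ?_ |>.upperSemicontinuousOn _
      simp only [hf]
      fun_prop
    · exact ((hX Y).mk' _ |>.concaveOn (Spectraplex.convex m)).quasiconcaveOn
  refine ⟨f Y₀ X₀, ⟨⟨X₀, hX₀, ?_⟩, ?_⟩, ⟨Y₀, hY₀, ?_⟩, ?_⟩
  · exact (posSemidef_sub_smul_one_iff (hA.sliceX_isSymm X₀) _).mpr
      fun Y hY => hsaddle Y hY X₀ hX₀
  · rintro v ⟨X, hX, hv⟩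
    exact ((posSemidef_sub_smul_one_iff (hA.sliceX_isSymm X) v).mp hv Y₀ hY₀).trans
      (hsaddle Y₀ hY₀ X hX)
  · exact (posSemidef_smul_one_sub_iff (hA.sliceY_isSymm Y₀) _).mpr
      fun X hX => hf Y₀ X ▸ hsaddle Y₀ hY₀ X hX
  · rintro u ⟨Y, hY, hu⟩
    exact (hsaddle Y hY X₀ hX₀).trans
      (hf Y X₀ ▸ (posSemidef_smul_one_sub_iff (hA.sliceY_isSymm Y) u).mp hu X₀ hX₀)
end

section
/- Let A₁, …, A_m, C ∈ Sym_n and b ∈ ℝ^m, and let (ȳ, X̄, t̄) be a solution of the associated semidefinite Dantzig game: ȳ ≥ 0 componentwise, X̄ ⪰ 0, t̄ ≥ 0, 𝟙ᵀȳ + tr(X̄) + t̄ = 1, ⟨A_i, X̄⟩ − b_i t̄ ≥ 0 for all i, t̄·C − Σ_{j=1}^m ȳ_j A_j ⪰ 0, and bᵀȳ − ⟨C, X̄⟩ ≥ 0. If t̄ > 0, then t̄⁻¹X̄ is an optimal solution of the primal SDP min_X { ⟨C, X⟩ : ⟨A_i, X⟩ ≥ b_i for all i, X ⪰ 0 } and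 t̄⁻¹ȳ is an optimal solution of the dual SDP max_y { bᵀy : y ≥ 0, C − Σ_i y_i A_i ⪰ 0 }; that is, t̄⁻¹X̄ is primal feasible, t̄⁻¹ȳ is dual feasible, ⟨C, t̄⁻¹X̄⟩ ≤ ⟨C, X⟩ for every primal feasible X, and bᵀ(t̄⁻¹ȳ) ≥ bᵀy for every dual feasible y. -/
open Matrix BigOperators

/-- The Frobenius inner product `⟨M, N⟩ = Σ_{i,j} M_{ij} N_{ij}`. -/
def frob {n : ℕ} (M N : Matrix (Fin n) (Fin n) ℝ) : ℝ :=
  ∑ i, ∑ j, M i j * N i j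

theorem frob_smul_right {n : ℕ} (M N : Matrix (Fin n) (Fin n) ℝ) (c : ℝ) :
    frob M (c • N) = c * frob M N := by
  simp only [frob, Matrix.smul_apply, smul_eq_mul, Finset.mul_sum, mul_left_comm]

theorem frob_sub_left {n : ℕ} (M M' N : Matrix (Fin n) (Fin n) ℝ) :
    frob (M - M') N = frob M N - frob M' N := by
  simp only [frob, Matrix.sub_apply, sub_mul, Finset.sum_sub_distrib]

theorem frob_sum_smul_left {m n : ℕ} (y : Fin m → ℝ) (A : Fin m → Matrix (Fin n) (Fin n) ℝ)
    (N : Matrix (Fin n) (Fin n) ℝ) :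
    frob (∑ k, y k • A k) N = ∑ k, y k * frob (A k) N := by
  simp only [frob, Matrix.sum_apply, Matrix.smul_apply, smul_eq_mul, Finset.sum_mul,
    Finset.mul_sum, mul_assoc]
  exact (Finset.sum_congr rfl fun _ _ => Finset.sum_comm).trans Finset.sum_comm

/-- The cone of positive semidefinite matrices pairs nonnegatively with itself. -/
theorem frob_nonneg {n : ℕ} {M N : Matrix (Fin n) (Fin n) ℝ}
    (hM : M.PosSemidef) (hN : N.PosSemidef) : 0 ≤ frob M N := by
  have h := (hM.hadamard hN).dotProduct_mulVec_nonneg 1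
  simpa [frob, dotProduct, mulVec] using h

/-- Weak duality for semidefinite programs. -/
theorem sdp_weak_duality {m n : ℕ} {A : Fin m → Matrix (Fin n) (Fin n) ℝ}
    {C X : Matrix (Fin n) (Fin n) ℝ} {b y : Fin m → ℝ}
    (hX : X.PosSemidef) (hAX : ∀ i, b i ≤ frob (A i) X)
    (hy : ∀ i, 0 ≤ y i) (hS : (C - ∑ i, y i • A i).PosSemidef) :
    ∑ i, b i * y i ≤ frob C X := by
  have h := frob_nonneg hS hX
  rw [frob_sub_left, frob_sum_smul_left] at h
  have hsum : ∑ i, b i * y i ≤ ∑ i, y i * frob (A i) X :=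
    Finset.sum_le_sum fun i _ => by
      rw [mul_comm]
      exact mul_le_mul_of_nonneg_left (hAX i) (hy i)
  linarith

theorem dantzig_game_recovers_SDP_optima {m n : ℕ}
    (A : Fin m → Matrix (Fin n) (Fin n) ℝ) (C : Matrix (Fin n) (Fin n) ℝ)
    (b : Fin m → ℝ)
    (hAsym : ∀ i, (A i).IsSymm) (hCsym : C.IsSymm)
    (ybar : Fin m → ℝ) (Xbar : Matrix (Fin n) (Fin n) ℝ) (tbar : ℝ)
    (hy : ∀ i, 0 ≤ ybar i) (hX : Xbar.PosSemidef) (ht : 0 ≤ tbar)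
    (htr : (∑ i, ybar i) + Xbar.trace + tbar = 1)
    (h1 : ∀ i, 0 ≤ frob (A i) Xbar - b i * tbar)
    (h2 : (tbar • C - ∑ j, ybar j • A j).PosSemidef)
    (h3 : 0 ≤ (∑ i, b i * ybar i) - frob C Xbar)
    (htpos : 0 < tbar) :
    (tbar⁻¹ • Xbar).PosSemidef ∧
    (∀ i, b i ≤ frob (A i) (tbar⁻¹ • Xbar)) ∧
    (∀ i, 0 ≤ tbar⁻¹ * ybar i) ∧
    (C - ∑ i, (tbar⁻¹ * ybar i) • A i).PosSemidef ∧
    (∀ X : Matrix (Fin n) (Fin n) ℝ, X.PosSemidef → (∀ i, b i ≤ frob (A i) X) →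
      frob C (tbar⁻¹ • Xbar) ≤ frob C X) ∧
    (∀ y : Fin m → ℝ, (∀ i, 0 ≤ y i) → (C - ∑ i, y i • A i).PosSemidef →
      ∑ i, b i * y i ≤ ∑ i, b i * (tbar⁻¹ * ybar i)) := by
  have hinv : 0 ≤ tbar⁻¹ := inv_nonneg.mpr ht
  have hXfeas : (tbar⁻¹ • Xbar).PosSemidef := hX.smul hinv
  have hAX : ∀ i, b i ≤ frob (A i) (tbar⁻¹ • Xbar) := fun i => by
    rw [frob_smul_right, le_inv_mul_iff₀ htpos]
    linarith [h1 i]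
  have hyfeas : ∀ i, 0 ≤ tbar⁻¹ * ybar i := fun i => mul_nonneg hinv (hy i)
  have hS : (C - ∑ i, (tbar⁻¹ * ybar i) • A i).PosSemidef := by
    have h := h2.smul hinv
    rwa [smul_sub, inv_smul_smul₀ htpos.ne', Finset.smul_sum,
      Finset.sum_congr rfl fun i _ => smul_smul tbar⁻¹ (ybar i) (A i)] at h
  have hgap : frob C (tbar⁻¹ • Xbar) ≤ ∑ i, b i * (tbar⁻¹ * ybar i) := by
    simp_rw [frob_smul_right, mul_left_comm (b _), ← Finset.mul_sum]
    exact mul_le_mul_of_nonneg_left (sub_nonneg.mp h3) hinv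
  exact ⟨hXfeas, hAX, hyfeas, hS,
    fun X hX' hAX' => hgap.trans (sdp_weak_duality hX' hAX' hyfeas hS),
    fun y hy' hS' => (sdp_weak_duality hXfeas hAX hy' hS').trans hgap⟩
end
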